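/- arXiv:2211.05903 — 5 statements merged into one kernel-verified Lean document; each statement's English description precedes it below -/
import Mathlib

section
/- Let Ξ ⊆ ℝ^k be a nonempty compact convex set, let f : ℝ^k → ℝ be convex and continuous, let λ ≥ 0, and let ζ ∈ Ξ. Then the supremum of f(ξ) − λ‖ξ − ζ‖ over ξ ∈ Ξ is attained at a point of {ζ} ∪ ∂Ξ, where ∂Ξ denotes the topological frontier (boundary) of Ξ. -/
/-- Compact case of Theorem 3.2: the sup of `f(ξ) - λ‖ξ - ζ‖` over a nonempty
compact convex `Ξ` is attained at a point of `{ζ} ∪ ∂Ξ`. -/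
theorem stmt_3 (k : ℕ) (Xi : Set (EuclideanSpace ℝ (Fin k)))
    (hne : Xi.Nonempty) (hcomp : IsCompact Xi) (hconv : Convex ℝ Xi)
    (f : EuclideanSpace ℝ (Fin k) → ℝ)
    (hf : ConvexOn ℝ Set.univ f) (hfc : Continuous f)
    (lam : ℝ) (hlam : 0 ≤ lam)
    (ζ : EuclideanSpace ℝ (Fin k)) (hζ : ζ ∈ Xi) :
    ∃ ξs ∈ ({ζ} : Set (EuclideanSpace ℝ (Fin k))) ∪ frontier Xi,
      ξs ∈ Xi ∧ ∀ ξ ∈ Xi, f ξ - lam * ‖ξ - ζ‖ ≤ f ξs - lam * ‖ξs - ζ‖ := by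
  have hgc : Continuous (fun ξ => f ξ - lam * ‖ξ - ζ‖) := by fun_prop
  obtain ⟨x0, hx0, hmax0⟩ := hcomp.exists_isMaxOn hne hgc.continuousOn
  have hMc : IsCompact (Xi ∩ {ξ | f x0 - lam * ‖x0 - ζ‖ ≤ f ξ - lam * ‖ξ - ζ‖}) :=
    hcomp.inter_right (isClosed_le continuous_const hgc)
  have hdc : Continuous (fun ξ : EuclideanSpace ℝ (Fin k) => ‖ξ - ζ‖) := by fun_prop
  obtain ⟨m, ⟨hmX, hm⟩, hfar⟩ := hMc.exists_isMaxOn ⟨x0, hx0, le_refl (f x0 - lam * ‖x0 - ζ‖)⟩ hdc.continuousOn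
  have hm' : f x0 - lam * ‖x0 - ζ‖ ≤ f m - lam * ‖m - ζ‖ := hm
  have hopt : ∀ ξ ∈ Xi, f ξ - lam * ‖ξ - ζ‖ ≤ f m - lam * ‖m - ζ‖ :=
    fun ξ hξ => le_trans (hmax0 hξ) hm'
  refine ⟨m, ?_, hmX, hopt⟩
  by_contra hcon
  rw [Set.mem_union, not_or, Set.mem_singleton_iff] at hcon
  obtain ⟨hne', hfr⟩ := hcon
  have hint : m ∈ interior Xi := by
    by_contra h
    exact hfr ⟨subset_closure hmX, h⟩
  have hcont : Continuous (fun t : ℝ => m + t • (m - ζ)) := by fun_prop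
  have hev : ∀ᶠ t : ℝ in nhds 0, m + t • (m - ζ) ∈ Xi := by
    apply hcont.continuousAt.eventually_mem
    simpa using mem_interior_iff_mem_nhds.mp hint
  obtain ⟨t, htX, ht⟩ := ((hev.filter_mono nhdsWithin_le_nhds).and
    (self_mem_nhdsWithin : Set.Ioi (0 : ℝ) ∈ nhdsWithin 0 (Set.Ioi 0))).exists
  have ht0 : 0 < t := ht
  have hN : 0 < ‖m - ζ‖ := norm_pos_iff.mpr (sub_ne_zero.mpr hne')
  have hn : ‖m + t • (m - ζ) - ζ‖ = (1 + t) * ‖m - ζ‖ := by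
    have : m + t • (m - ζ) - ζ = (1 + t) • (m - ζ) := by module
    rw [this, norm_smul, Real.norm_of_nonneg (by positivity)]
  have hc := hf.2 (Set.mem_univ (m + t • (m - ζ))) (Set.mem_univ ζ)
    (show 0 ≤ 1 / (1 + t) by positivity) (show 0 ≤ t / (1 + t) by positivity) (by field_simp)
  have he : (1 / (1 + t)) • (m + t • (m - ζ)) + (t / (1 + t)) • ζ = m := by
    match_scalars <;> field_simp <;> ring
  rw [he, smul_eq_mul, smul_eq_mul] at hc
  have hc2 : (1 + t) * f m ≤ f (m + t • (m - ζ)) + t * f ζ := by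
    have h := mul_le_mul_of_nonneg_left hc (by positivity : 0 ≤ 1 + t)
    have e : (1 + t) * (1 / (1 + t) * f (m + t • (m - ζ)) + t / (1 + t) * f ζ)
        = f (m + t • (m - ζ)) + t * f ζ := by field_simp
    rwa [e] at h
  have hz := hopt ζ hζ
  rw [sub_self, norm_zero, mul_zero, sub_zero] at hz
  have hz2 := mul_le_mul_of_nonneg_left hz ht0.le
  have hge : f x0 - lam * ‖x0 - ζ‖ ≤
      f (m + t • (m - ζ)) - lam * ‖m + t • (m - ζ) - ζ‖ := by
    rw [hn]
    linarith
  have hle : ‖m + t • (m - ζ) - ζ‖ ≤ ‖m - ζ‖ := hfar ⟨htX, hge⟩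
  rw [hn] at hle
  have := mul_pos ht0 hN
  linarith
end

section
/- Let Ξ ⊆ ℝ^k be a nonempty closed convex set, let f : ℝ^k → ℝ be convex and continuous, let λ ≥ 0, and let ζ ∈ Ξ. If the set { f(ξ) − λ‖ξ − ζ‖ : ξ ∈ Ξ } is bounded above, then sup_{ξ ∈ Ξ} ( f(ξ) − λ‖ξ − ζ‖ ) = sup_{ξ ∈ {ζ} ∪ ∂Ξ} ( f(ξ) − λ‖ξ − ζ‖ ), where ∂Ξ denotes the topological frontier (boundary) of Ξ. -/
/-- Theorem 3.2 (general closed convex support): if the inner supremum problem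
is bounded above, its value is unchanged when restricting to `{ζ} ∪ ∂Ξ`. -/
theorem stmt_5 (k : ℕ) (Xi : Set (EuclideanSpace ℝ (Fin k)))
    (hne : Xi.Nonempty) (hclosed : IsClosed Xi) (hconv : Convex ℝ Xi)
    (f : EuclideanSpace ℝ (Fin k) → ℝ)
    (hf : ConvexOn ℝ Set.univ f) (hfc : Continuous f)
    (lam : ℝ) (hlam : 0 ≤ lam)
    (ζ : EuclideanSpace ℝ (Fin k)) (hζ : ζ ∈ Xi)
    (hbdd : BddAbove ((fun ξ => f ξ - lam * ‖ξ - ζ‖) '' Xi)) :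
    sSup ((fun ξ => f ξ - lam * ‖ξ - ζ‖) '' Xi)
      = sSup ((fun ξ => f ξ - lam * ‖ξ - ζ‖) ''
          (({ζ} : Set (EuclideanSpace ℝ (Fin k))) ∪ frontier Xi)) := by
  classical
  set F : EuclideanSpace ℝ (Fin k) → ℝ := fun ξ => f ξ - lam * ‖ξ - ζ‖ with hF
  have hsub : (({ζ} : Set (EuclideanSpace ℝ (Fin k))) ∪ frontier Xi) ⊆ Xi := by
    rintro x (hx | hx)
    · rw [Set.mem_singleton_iff.1 hx]; exact hζ
    · exact hclosed.frontier_subset hx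
  have hbdd' : BddAbove (F '' (({ζ} : Set (EuclideanSpace ℝ (Fin k))) ∪ frontier Xi)) :=
    hbdd.mono (Set.image_mono hsub)
  have hζmem : ζ ∈ (({ζ} : Set (EuclideanSpace ℝ (Fin k))) ∪ frontier Xi) := Or.inl rfl
  apply le_antisymm
  swap
  · exact csSup_le_csSup hbdd ⟨_, ζ, hζmem, rfl⟩ (Set.image_mono hsub)
  apply csSup_le (hne.image F)
  rintro _ ⟨ξ, hξ, rfl⟩
  -- the basic convexity inequality along the ray
  have key : ∀ s : ℝ, 1 ≤ s → s * F ξ ≤ (s - 1) * F ζ + F (ζ + s • (ξ - ζ)) := by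
    intro s hs
    have hs0 : 0 < s := by linarith
    have h := hf.2 (Set.mem_univ ζ) (Set.mem_univ (ζ + s • (ξ - ζ)))
      (show 0 ≤ 1 - s⁻¹ by have := inv_le_one_of_one_le₀ hs; linarith)
      (show 0 ≤ s⁻¹ by positivity) (by ring)
    have e : (1 - s⁻¹) • ζ + s⁻¹ • (ζ + s • (ξ - ζ)) = ξ := by
      rw [smul_add, smul_smul, inv_mul_cancel₀ hs0.ne']
      module
    rw [e] at h
    simp only [smul_eq_mul] at h
    have h2 := mul_le_mul_of_nonneg_left h hs0.le
    have e2 : s * ((1 - s⁻¹) * f ζ + s⁻¹ * f (ζ + s • (ξ - ζ)))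
        = (s - 1) * f ζ + f (ζ + s • (ξ - ζ)) := by
      field_simp
    rw [e2] at h2
    simp only [hF, add_sub_cancel_left, sub_self, norm_zero, norm_smul, Real.norm_eq_abs,
      abs_of_pos hs0]
    linarith
  by_cases hle : F ξ ≤ F ζ
  · exact hle.trans (le_csSup hbdd' ⟨ζ, hζmem, rfl⟩)
  push Not at hle
  -- the ray leaves `Xi`
  have hex : ∃ s : ℝ, 1 ≤ s ∧ ζ + s • (ξ - ζ) ∉ Xi := by
    by_contra! hall
    obtain ⟨M, hM⟩ := hbdd
    have hpos : 0 < F ξ - F ζ := by linarith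
    have hb : ∀ s : ℝ, 1 ≤ s → s * (F ξ - F ζ) ≤ M - F ζ := by
      intro s hs
      have := hM ⟨_, hall s hs, rfl⟩
      have := key s hs
      linarith
    have h1 := hb (max 1 ((M - F ζ) / (F ξ - F ζ) + 1)) (le_max_left _ _)
    have h2 := mul_le_mul_of_nonneg_right
      (le_max_right 1 ((M - F ζ) / (F ξ - F ζ) + 1)) hpos.le
    rw [add_mul, div_mul_cancel₀ _ hpos.ne'] at h2
    linarith
  obtain ⟨T, hT, hTn⟩ := hex
  have hfr : ∃ s : ℝ, 1 ≤ s ∧ ζ + s • (ξ - ζ) ∈ frontier Xi := by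
    have hc : Continuous fun s : ℝ => ζ + s • (ξ - ζ) := by fun_prop
    have hpre : IsPreconnected ((fun s : ℝ => ζ + s • (ξ - ζ)) '' Set.Icc 1 T) :=
      isPreconnected_Icc.image _ hc.continuousOn
    by_contra! hno
    have hint : ∀ s : ℝ, 1 ≤ s → ζ + s • (ξ - ζ) ∈ Xi → ζ + s • (ξ - ζ) ∈ interior Xi := by
      intro s hs hx
      by_contra hni
      exact hno s hs ⟨subset_closure hx, hni⟩
    obtain ⟨x, -, hx1, hx2⟩ := hpre (interior Xi) Xiᶜ isOpen_interior hclosed.isOpen_compl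
      (by
        rintro _ ⟨s, hs, rfl⟩
        by_cases hx : ζ + s • (ξ - ζ) ∈ Xi
        · exact Or.inl (hint s hs.1 hx)
        · exact Or.inr hx)
      ⟨_, ⟨1, ⟨le_rfl, hT⟩, rfl⟩, hint 1 le_rfl (by simpa using hξ)⟩
      ⟨_, ⟨T, ⟨hT, le_rfl⟩, rfl⟩, hTn⟩
    exact hx2 (interior_subset hx1)
  obtain ⟨s, hs, hsf⟩ := hfr
  refine le_trans ?_ (le_csSup hbdd' ⟨_, Or.inr hsf, rfl⟩)
  have h1 := key s hs
  nlinarith [mul_nonneg (sub_nonneg.2 hs) (sub_nonneg.2 hle.le)]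
end

section
/- Let f : ℝ^k → ℝ be convex, let λ ≥ 0, and let ζ ∈ ℝ^k. If the set { f(ξ) − λ‖ξ − ζ‖ : ξ ∈ ℝ^k } is bounded above, then sup_{ξ ∈ ℝ^k} ( f(ξ) − λ‖ξ − ζ‖ ) = f(ζ). -/
/-- Core of Corollary 3.6: with unconstrained support `Ξ = ℝ^k`, if
`f(ξ) - λ‖ξ - ζ‖` is bounded above then its supremum equals `f(ζ)`. -/
theorem stmt_6 (k : ℕ) (f : EuclideanSpace ℝ (Fin k) → ℝ)
    (hf : ConvexOn ℝ Set.univ f) (lam : ℝ) (hlam : 0 ≤ lam)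
    (ζ : EuclideanSpace ℝ (Fin k))
    (hbdd : BddAbove (Set.range fun ξ => f ξ - lam * ‖ξ - ζ‖)) :
    sSup (Set.range fun ξ => f ξ - lam * ‖ξ - ζ‖) = f ζ := by
  obtain ⟨M, hM⟩ := hbdd
  have hM' : ∀ ξ, f ξ - lam * ‖ξ - ζ‖ ≤ M := fun ξ => hM ⟨ξ, rfl⟩
  have h0 : f ζ ≤ M := by simpa using hM' ζ
  apply IsGreatest.csSup_eq
  refine ⟨⟨ζ, by simp⟩, ?_⟩
  rintro _ ⟨ξ, rfl⟩
  show f ξ - lam * ‖ξ - ζ‖ ≤ f ζ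
  by_contra! hlt
  obtain ⟨d, hd⟩ : ∃ d, d = f ξ - lam * ‖ξ - ζ‖ - f ζ := ⟨_, rfl⟩
  have hdpos : 0 < d := by linarith
  obtain ⟨t, ht⟩ : ∃ t, t = (M - f ζ) / d + 1 := ⟨_, rfl⟩
  have hq : 0 ≤ (M - f ζ) / d := div_nonneg (by linarith) hdpos.le
  have ht1 : 1 ≤ t := by linarith
  have htpos : 0 < t := by linarith
  have htd : t * d = M - f ζ + d := by
    rw [ht]; field_simp
  have hinv : t⁻¹ ≤ 1 := inv_le_one_of_one_le₀ ht1
  have hc := hf.2 (Set.mem_univ ζ) (Set.mem_univ (ζ + t • (ξ - ζ)))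
    (sub_nonneg.2 hinv) (inv_nonneg.2 htpos.le) (by ring)
  have he : (1 - t⁻¹) • ζ + t⁻¹ • (ζ + t • (ξ - ζ)) = ξ := by
    rw [smul_add, smul_smul, inv_mul_cancel₀ htpos.ne']
    module
  rw [he] at hc
  have hy := hM' (ζ + t • (ξ - ζ))
  rw [add_sub_cancel_left, norm_smul, Real.norm_of_nonneg htpos.le] at hy
  simp only [smul_eq_mul] at hc
  have hc2 := mul_le_mul_of_nonneg_left hc htpos.le
  have he2 : t * ((1 - t⁻¹) * f ζ + t⁻¹ * f (ζ + t • (ξ - ζ)))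
      = (t - 1) * f ζ + f (ζ + t • (ξ - ζ)) := by
    field_simp
  rw [he2] at hc2
  rw [hd] at htd
  nlinarith
end

section
/- Let a, λ, l, ζ be real numbers with λ ≥ 0 and l ≤ ζ. Then the set { a·t − λ·|t − ζ| : t ∈ [l, ∞) } is bounded above if and only if a ≤ λ; and when a ≤ λ, sup_{t ≥ l} ( a·t − λ·|t − ζ| ) = max( a·ζ, a·l − λ·(ζ − l) ). -/
/-- Unbounded-coordinate case of the coordinatewise subproblem in
Proposition 3.4. -/
theorem stmt_13 (a lam l ζ : ℝ) (hlam : 0 ≤ lam) (hl : l ≤ ζ) :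
    (BddAbove ((fun t => a * t - lam * |t - ζ|) '' Set.Ici l) ↔ a ≤ lam) ∧
    (a ≤ lam →
      sSup ((fun t => a * t - lam * |t - ζ|) '' Set.Ici l)
        = max (a * ζ) (a * l - lam * (ζ - l))) := by
  have key : a ≤ lam → IsGreatest ((fun t => a * t - lam * |t - ζ|) '' Set.Ici l)
      (max (a * ζ) (a * l - lam * (ζ - l))) := by
    intro ha
    constructor
    · rcases max_choice (a * ζ) (a * l - lam * (ζ - l)) with h | h
      · rw [h]
        exact ⟨ζ, hl, by simp⟩
      · rw [h]
        refine ⟨l, Set.mem_Ici.2 le_rfl, ?_⟩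
        simp only
        rw [abs_of_nonpos (by linarith)]
        ring
    · rintro _ ⟨t, ht, rfl⟩
      have ht : l ≤ t := ht
      simp only
      rcases le_total ζ t with h | h
      · apply le_max_of_le_left
        rw [abs_of_nonneg (by linarith)]
        nlinarith [mul_nonneg (sub_nonneg.2 ha) (sub_nonneg.2 h)]
      · rw [abs_of_nonpos (by linarith)]
        rcases le_total 0 (a + lam) with h0 | h0
        · apply le_max_of_le_left
          nlinarith [mul_nonneg h0 (sub_nonneg.2 h)]
        · apply le_max_of_le_right
          nlinarith [mul_nonneg (neg_nonneg.2 h0) (sub_nonneg.2 ht)]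
  refine ⟨⟨?_, fun ha => (key ha).bddAbove⟩, fun ha => (key ha).csSup_eq⟩
  rintro ⟨M, hM⟩
  by_contra! hlt
  have hd : 0 < a - lam := sub_pos.2 hlt
  obtain ⟨s, hs⟩ : ∃ s, s = (|M - a * ζ| + 1) / (a - lam) := ⟨_, rfl⟩
  have hs0 : 0 ≤ s := by rw [hs]; positivity
  have hs1 : s * (a - lam) = |M - a * ζ| + 1 := by
    rw [hs]; field_simp
  have hmem := hM ⟨ζ + s, Set.mem_Ici.2 (by linarith), rfl⟩
  simp only [add_sub_cancel_left, abs_of_nonneg hs0] at hmem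
  nlinarith [le_abs_self (M - a * ζ)]
end

section
/- For every real ε > 0, inf_{λ ≥ 1} ( ε·λ + 2·max(0, 2 − λ) ) = min( ε + 2, 2ε ), and this value is strictly greater than ε. -/
/-- Final computation of Example 3.8. -/
theorem stmt_16 (ε : ℝ) (hε : 0 < ε) :
    sInf ((fun lam => ε * lam + 2 * max 0 (2 - lam)) '' Set.Ici (1 : ℝ))
        = min (ε + 2) (2 * ε) ∧
    ε < min (ε + 2) (2 * ε) := by
  refine ⟨?_, lt_min (by linarith) (by linarith)⟩
  apply IsLeast.csInf_eq
  constructor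
  · rcases le_total (ε + 2) (2 * ε) with h | h
    · rw [min_eq_left h]
      refine ⟨1, Set.mem_Ici.2 le_rfl, ?_⟩
      norm_num
    · rw [min_eq_right h]
      refine ⟨2, Set.mem_Ici.2 one_le_two, ?_⟩
      norm_num
      ring
  · rintro _ ⟨x, hx, rfl⟩
    have hx1 : (1 : ℝ) ≤ x := hx
    have h1 := min_le_left (ε + 2) (2 * ε)
    have h2 := min_le_right (ε + 2) (2 * ε)
    show min (ε + 2) (2 * ε) ≤ ε * x + 2 * max 0 (2 - x)
    rcases le_total x 2 with h | h
    · rw [max_eq_right (by linarith)]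
      nlinarith [mul_le_mul_of_nonneg_left h1 (sub_nonneg.2 h),
        mul_le_mul_of_nonneg_left h2 (sub_nonneg.2 hx1)]
    · rw [max_eq_left (by linarith)]
      nlinarith
end
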